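/- Let φ be a (2,3)-CNF formula with n variables (each clause exactly two literals, each variable in at least 2 and at most 3 clauses), and let T_φ be the Tournament Value Maximization instance obtained from φ by Construction 2. Then the maximum tournament value over all tournament seedings of T_φ equals the maximum number of simultaneously satisfiable clauses of φ plus n. -/

import Mathlib

/-- Players are natural numbers; player `i` beats player `j` iff `i > j`.
Hence the winner of a (sub)tournament is its strongest player, i.e. the maximum
of the list of participating players. -/
def winner (l : List ℕ) : ℕ := l.foldr max 0

/-- The tournament value of the seeding given by the list `l` of players in
seed-position order (`l.length = 2 ^ m`), with respect to the game-value
function `v`: the value of a tournament on a single player is `0`; otherwise it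
is the value of the subtournament of the first half of the seed positions, plus
the value of the subtournament of the second half, plus `v i₁ i₂ m` where
`i₁, i₂` are the winners of the two halves playing each other in the final
round `m`. -/
def tourValue (v : ℕ → ℕ → ℕ → ℤ) : ℕ → List ℕ → ℤ
  | 0, _ => 0
  | m + 1, l =>
      tourValue v m (l.take (2 ^ m)) + tourValue v m (l.drop (2 ^ m)) +
        v (winner (l.take (2 ^ m))) (winner (l.drop (2 ^ m))) (m + 1)

/-- `l` is a tournament seeding for the player set `N` iff `l` lists the
elements of `N`, each exactly once, in seed-position order. -/
def IsSeeding (N : Finset ℕ) (l : List ℕ) : Prop := l.Nodup ∧ l.toFinset = N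

/-- The number of games won by player `i` in the tournament with `m` rounds on
the seeding `l`: in each (sub)tournament, the final game is won by the stronger
of the winners of the two halves. -/
def winCount (i : ℕ) : ℕ → List ℕ → ℕ
  | 0, _ => 0
  | m + 1, l =>
      winCount i m (l.take (2 ^ m)) + winCount i m (l.drop (2 ^ m)) +
        if i = max (winner (l.take (2 ^ m))) (winner (l.drop (2 ^ m))) then 1 else 0

/-- A clause with exactly two literals; a literal is a pair
(variable, polarity). -/
abbrev Clause2 := (ℕ × Bool) × (ℕ × Bool)

/-- The assignment `α` satisfies the clause `c` if it makes at least one of its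
two literals true. -/
def clauseSat (α : ℕ → Bool) (c : Clause2) : Bool :=
  (α c.1.1 == c.1.2) || (α c.2.1 == c.2.2)

/-- The number of clauses of `cs` satisfied by the assignment `α`. -/
def satCount (α : ℕ → Bool) (cs : List Clause2) : ℕ := cs.countP (clauseSat α)

/-- The list of all literal occurrences of the formula, in order. -/
def lits (cs : List Clause2) : List (ℕ × Bool) :=
  cs.foldr (fun c acc => c.1 :: c.2 :: acc) []

/-- `cs` is a (2,3)-CNF formula on the variables `1, …, n`: each clause has two
literals on two distinct variables from `{1, …, n}`, and each variable occurs
(equivalently, appears in) at least `2` and at most `3` clauses. -/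
def Good23 (n : ℕ) (cs : List Clause2) : Prop :=
  (∀ c ∈ cs, 1 ≤ c.1.1 ∧ c.1.1 ≤ n ∧ 1 ≤ c.2.1 ∧ c.2.1 ≤ n ∧ c.1.1 ≠ c.2.1) ∧
  (∀ x : ℕ, 1 ≤ x → x ≤ n →
      2 ≤ (lits cs).countP (fun p => p.1 == x) ∧
        (lits cs).countP (fun p => p.1 == x) ≤ 3)

/-- The total number of players `2 ^ n'`, where `n'` is the smallest integer
with `16 * n ≤ 2 ^ n'`.  The player set is `{0, 1, …, numP n - 1}` and the
`k`-th strongest player is the number `numP n - k`. -/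
def numP (n : ℕ) : ℕ := 2 ^ Nat.clog 2 (16 * n)

/-- The special player `d̂_i` (`i ∈ {1, …, n}`), of strength rank `3*i - 2`. -/
def dHat (n i : ℕ) : ℕ := numP n - (3 * i - 2)

/-- The special player `d_i`, of strength rank `3*i - 1`. -/
def dMid (n i : ℕ) : ℕ := numP n - (3 * i - 1)

/-- The special player `d̃_i`, of strength rank `3*i`. -/
def dTil (n i : ℕ) : ℕ := numP n - (3 * i)

/-- The variable player `x_i` (`i ∈ {1, …, n}`), of strength rank `3*n + 3*i - 2`. -/
def xPl (n i : ℕ) : ℕ := numP n - (3 * n + 3 * i - 2)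

/-- The variable player `x_i^T`, of strength rank `3*n + 3*i - 1`. -/
def xTPl (n i : ℕ) : ℕ := numP n - (3 * n + 3 * i - 1)

/-- The variable player `x_i^F`, of strength rank `3*n + 3*i`. -/
def xFPl (n i : ℕ) : ℕ := numP n - (3 * n + 3 * i)

/-- The clause player `c_j` (`j ∈ {1, …, m}`), of strength rank `6*n + j`;
the remaining numbers are the dummy players `f_1, …, f_{10n+p-m}`. -/
def cPl (n j : ℕ) : ℕ := numP n - (6 * n + j)

/-- The variable player corresponding to a literal: `x_i^T` for a positive and
`x_i^F` for a negative occurrence of `x_i`. -/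
def litPl (n : ℕ) (p : ℕ × Bool) : ℕ := if p.2 then xTPl n p.1 else xFPl n p.1

/-- The games of value `1` of Construction 2 (before symmetrisation):
`v (x_i) (x_i^T) = v (x_i) (x_i^F) = 1`, and `v c (x_i^T) = 1` when `x_i`
occurs positively in clause `c` and `v c (x_i^F) = 1` when `x_i` occurs
negatively in `c`. -/
def OneGame (n : ℕ) (cs : List Clause2) (a b : ℕ) : Prop :=
  (∃ i : ℕ, 1 ≤ i ∧ i ≤ n ∧ a = xPl n i ∧ (b = xTPl n i ∨ b = xFPl n i)) ∨
  (∃ j : ℕ, j < cs.length ∧ a = cPl n (j + 1) ∧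
      (b = litPl n (cs.getD j ((0, true), (0, true))).1 ∨
        b = litPl n (cs.getD j ((0, true), (0, true))).2))

/-- The explicitly zero-valued games of Construction 2 (before symmetrisation):
`v d_i (d̂_i) = v d_i (d̃_i) = v d_i (x_i) = 0`. -/
def ZeroGame (n a b : ℕ) : Prop :=
  ∃ i : ℕ, 1 ≤ i ∧ i ≤ n ∧ a = dMid n i ∧
    (b = dHat n i ∨ b = dTil n i ∨ b = xPl n i)

/-- `a` is one of the players `d_i` or `x_i` for some `i ∈ {1, …, n}`. -/
def DXPlayer (n a : ℕ) : Prop :=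
  ∃ i : ℕ, 1 ≤ i ∧ i ≤ n ∧ (a = dMid n i ∨ a = xPl n i)

open Classical in
/-- The (symmetric, round-oblivious) game-value function of Construction 2:
value `1` for the games described by `OneGame`; value `0` for the games
described by `ZeroGame`; value `-5` for every other game involving some `d_i`
or `x_i`; and value `0` for all remaining games. -/
noncomputable def gv2 (n : ℕ) (cs : List Clause2) (a b _r : ℕ) : ℤ :=
  if OneGame n cs a b ∨ OneGame n cs b a then 1
  else if ZeroGame n a b ∨ ZeroGame n b a then 0
  else if DXPlayer n a ∨ DXPlayer n b then -5
  else 0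

theorem winner_append (l₁ l₂ : List ℕ) : winner (l₁ ++ l₂) = max (winner l₁) (winner l₂) := by
  induction l₁ with
  | nil => simp [winner]
  | cons a l ih => simp only [winner, List.cons_append, List.foldr_cons] at ih ⊢; rw [ih, max_assoc]

theorem le_winner {l : List ℕ} {a : ℕ} (h : a ∈ l) : a ≤ winner l := by
  induction l with
  | nil => simp at h
  | cons b l ih =>
    simp only [winner, List.foldr_cons, le_max_iff]
    rcases List.mem_cons.1 h with rfl | h
    · exact .inl le_rfl
    · exact .inr (ih h)

theorem winner_mem {l : List ℕ} (h : l ≠ []) : winner l ∈ l := by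
  induction l with
  | nil => simp at h
  | cons b l ih =>
    rcases eq_or_ne l [] with rfl | hl
    · simp [winner]
    · rcases max_choice b (winner l) with hb | hb
      · simp only [winner, List.foldr_cons] at hb ⊢; simp [hb]
      · have := ih hl
        simp only [winner, List.foldr_cons] at hb this ⊢; simp [hb, this]

theorem tourValue_append (v : ℕ → ℕ → ℕ → ℤ) {m : ℕ} {l₁ l₂ : List ℕ} (h : l₁.length = 2 ^ m) :
    tourValue v (m + 1) (l₁ ++ l₂) =
      tourValue v m l₁ + tourValue v m l₂ + v (winner l₁) (winner l₂) (m + 1) := by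
  simp only [tourValue, List.take_left' h, List.drop_left' h]

/-- The results of an `m`-round tournament on the players `S` with champion `W` and value `V`:
every other player `a` loses to `β a` in round `ρ a`. By convention the champion has
`ρ W = m + 1`. -/
structure Knockout (v : ℕ → ℕ → ℕ → ℤ) (S : Finset ℕ) (W m : ℕ) (V : ℤ) (β ρ : ℕ → ℕ) :
    Prop where
  mem : W ∈ S
  top : ρ W = m + 1
  beats : ∀ a ∈ S, a ≠ W → β a ∈ S ∧ a < β a ∧ 1 ≤ ρ a ∧ ρ a < ρ (β a)
  inj : ∀ a ∈ S, ∀ b ∈ S, a ≠ W → b ≠ W → β a = β b → ρ a = ρ b → a = b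
  surj : ∀ a ∈ S, ∀ r, 1 ≤ r → r < ρ a → ∃ b ∈ S, b ≠ W ∧ β b = a ∧ ρ b = r
  value : V = ∑ a ∈ S.erase W, v (β a) a (ρ a)

theorem Knockout.join {v : ℕ → ℕ → ℕ → ℤ} {S₁ S₂ : Finset ℕ} {W₁ W₂ m : ℕ} {V₁ V₂ : ℤ}
    {β₁ ρ₁ β₂ ρ₂ : ℕ → ℕ} (h₁ : Knockout v S₁ W₁ m V₁ β₁ ρ₁) (h₂ : Knockout v S₂ W₂ m V₂ β₂ ρ₂)
    (hd : Disjoint S₁ S₂) (hW : W₂ < W₁) :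
    ∃ β ρ, Knockout v (S₁ ∪ S₂) W₁ (m + 1) (V₁ + V₂ + v W₁ W₂ (m + 1)) β ρ := by
  have hn : ∀ a ∈ S₁, a ∉ S₂ := fun a ha => Finset.disjoint_left.1 hd ha
  let β : ℕ → ℕ := fun a => if a = W₂ then W₁ else if a ∈ S₁ then β₁ a else β₂ a
  let ρ : ℕ → ℕ := fun a => if a = W₁ then m + 2 else if a ∈ S₁ then ρ₁ a else ρ₂ a
  have hW₁ := h₁.mem
  have hW₂ := h₂.mem
  have ht₁ := h₁.top
  have ht₂ := h₂.top
  have b1 : ∀ a ∈ S₁, β a = β₁ a := fun a ha => by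
    have : a ≠ W₂ := fun h => hn a ha (h ▸ hW₂)
    simp [β, ha, this]
  have b2 : ∀ a ∈ S₂, a ≠ W₂ → β a = β₂ a := fun a ha h => by
    have : a ∉ S₁ := fun h => hn a h ha
    simp [β, h, this]
  have bW : β W₂ = W₁ := by simp [β]
  have r1 : ∀ a ∈ S₁, a ≠ W₁ → ρ a = ρ₁ a := fun a ha h => by simp [ρ, ha, h]
  have r2 : ∀ a ∈ S₂, ρ a = ρ₂ a := fun a ha => by
    have h : a ∉ S₁ := fun h => hn a h ha
    have : a ≠ W₁ := fun h' => h (h' ▸ hW₁)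
    simp [ρ, this, h]
  have rW : ρ W₁ = m + 2 := by simp [ρ]
  have hle : ∀ a ∈ S₁, ρ₁ a ≤ ρ a := fun a ha => by
    by_cases h : a = W₁
    · subst h; omega
    · exact (r1 a ha h).ge
  refine ⟨β, ρ, Finset.mem_union_left _ hW₁, rW, ?_, ?_, ?_, ?_⟩
  · intro a ha hne
    rcases Finset.mem_union.1 ha with ha | ha
    · obtain ⟨h1, h2, h3, h4⟩ := h₁.beats a ha hne
      rw [b1 a ha, r1 a ha hne]
      exact ⟨Finset.mem_union_left _ h1, h2, h3, h4.trans_le (hle _ h1)⟩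
    · by_cases h : a = W₂
      · subst h
        rw [bW, r2 _ ha, rW]
        exact ⟨Finset.mem_union_left _ hW₁, hW, by omega, by omega⟩
      · obtain ⟨h1, h2, h3, h4⟩ := h₂.beats a ha h
        rw [b2 a ha h, r2 a ha, r2 _ h1]
        exact ⟨Finset.mem_union_right _ h1, h2, h3, h4⟩
  · have key : ∀ a ∈ S₁, ∀ b ∈ S₂, a ≠ W₁ → β a = β b → ρ a = ρ b → a = b := by
      intro a ha b hb hne hβ hρ
      obtain ⟨h1, h2, h3, h4⟩ := h₁.beats a ha hne
      rw [b1 a ha] at hβ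
      rw [r1 a ha hne, r2 b hb] at hρ
      by_cases h : b = W₂
      · subst h; rw [bW] at hβ; rw [hβ] at h4; omega
      · obtain ⟨h1', -⟩ := h₂.beats b hb h
        rw [b2 b hb h] at hβ
        exact (hn _ h1 (hβ ▸ h1')).elim
    have key2 : ∀ b ∈ S₂, b ≠ W₂ → β W₂ = β b → False := by
      intro b hb h hβ
      obtain ⟨h1', -⟩ := h₂.beats b hb h
      rw [bW, b2 b hb h] at hβ
      exact hn _ hW₁ (hβ ▸ h1')
    intro a ha b hb hne hne' hβ hρ
    rcases Finset.mem_union.1 ha with ha | ha <;> rcases Finset.mem_union.1 hb with hb | hb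
    · rw [b1 a ha, b1 b hb] at hβ
      rw [r1 a ha hne, r1 b hb hne'] at hρ
      exact h₁.inj a ha b hb hne hne' hβ hρ
    · exact key a ha b hb hne hβ hρ
    · exact (key b hb a ha hne' hβ.symm hρ.symm).symm
    · by_cases h : a = W₂ <;> by_cases h' : b = W₂
      · rw [h, h']
      · subst h; exact (key2 b hb h' hβ).elim
      · subst h'; exact (key2 a ha h hβ.symm).elim
      · rw [b2 a ha h, b2 b hb h'] at hβ
        rw [r2 a ha, r2 b hb] at hρ
        exact h₂.inj a ha b hb h h' hβ hρ
  · intro a ha r hr hra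
    rcases Finset.mem_union.1 ha with ha | ha
    · by_cases h : r < ρ₁ a
      · obtain ⟨b, hb, hne, hβ, hρ⟩ := h₁.surj a ha r hr h
        exact ⟨b, Finset.mem_union_left _ hb, hne, by rw [b1 b hb, hβ], by rw [r1 b hb hne, hρ]⟩
      · by_cases h' : a = W₁
        · subst h'
          refine ⟨W₂, Finset.mem_union_right _ hW₂, hW.ne, bW, ?_⟩
          rw [r2 _ hW₂]; omega
        · rw [r1 a ha h'] at hra; omega
    · rw [r2 a ha] at hra
      obtain ⟨b, hb, hne, hβ, hρ⟩ := h₂.surj a ha r hr hra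
      refine ⟨b, Finset.mem_union_right _ hb, ?_, by rw [b2 b hb hne, hβ], by rw [r2 b hb, hρ]⟩
      rintro rfl
      exact hn _ hW₁ hb
  · have hu : (S₁ ∪ S₂).erase W₁ = S₁.erase W₁ ∪ S₂ := by
      rw [Finset.erase_union_distrib, Finset.erase_eq_of_notMem (hn _ hW₁)]
    have hd' : Disjoint (S₁.erase W₁) S₂ := hd.mono_left (Finset.erase_subset _ _)
    rw [hu, Finset.sum_union hd', h₁.value, h₂.value, ← Finset.sum_erase_add _ _ hW₂, bW,
      r2 _ hW₂, ht₂, add_assoc]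
    congr 1
    · refine Finset.sum_congr rfl fun a ha => ?_
      obtain ⟨hne, ha⟩ := Finset.mem_erase.1 ha
      rw [b1 a ha, r1 a ha hne]
    · congr 1
      refine Finset.sum_congr rfl fun a ha => ?_
      obtain ⟨hne, ha⟩ := Finset.mem_erase.1 ha
      rw [b2 a ha hne, r2 a ha]

theorem exists_knockout {v : ℕ → ℕ → ℕ → ℤ} (hv : ∀ a b r, v a b r = v b a r) (m : ℕ) :
    ∀ l : List ℕ, l.length = 2 ^ m → l.Nodup →
      ∃ β ρ, Knockout v l.toFinset (winner l) m (tourValue v m l) β ρ := by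
  induction m with
  | zero =>
    intro l hl _
    obtain ⟨a, rfl⟩ := List.length_eq_one_iff.1 (by simpa using hl)
    refine ⟨fun _ => 0, fun _ => 1, ?_, ?_, ?_, ?_, ?_, ?_⟩ <;> simp [winner, tourValue]
    omega
  | succ m ih =>
    intro l hl hnd
    obtain ⟨l₁, l₂, rfl, h₁⟩ : ∃ l₁ l₂, l = l₁ ++ l₂ ∧ l₁.length = 2 ^ m :=
      ⟨l.take (2 ^ m), l.drop (2 ^ m), by simp, by simp [hl, pow_succ]⟩
    have h₂ : l₂.length = 2 ^ m := by
      rw [List.length_append, pow_succ] at hl; omega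
    have hpos : 0 < 2 ^ m := by positivity
    have n₁ : l₁ ≠ [] := by rintro rfl; rw [List.length_nil] at h₁; omega
    have n₂ : l₂ ≠ [] := by rintro rfl; rw [List.length_nil] at h₂; omega
    obtain ⟨d₁, d₂, hd⟩ := List.nodup_append'.1 hnd
    have hd' : Disjoint l₁.toFinset l₂.toFinset := List.disjoint_toFinset_iff_disjoint.2 hd
    obtain ⟨β₁, ρ₁, k₁⟩ := ih l₁ h₁ d₁
    obtain ⟨β₂, ρ₂, k₂⟩ := ih l₂ h₂ d₂
    rw [tourValue_append v h₁, winner_append, List.toFinset_append]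
    have hne : winner l₁ ≠ winner l₂ := fun h =>
      hd (winner_mem n₁) (h ▸ winner_mem n₂)
    rcases hne.lt_or_gt with h | h
    · rw [max_eq_right h.le, hv, Finset.union_comm, add_comm (tourValue v m l₁)]
      exact k₂.join k₁ hd'.symm h
    · rw [max_eq_left h.le]
      exact k₁.join k₂ hd' h

/-- The `j`-th clause of the formula, with clauses numbered from `0`. -/
abbrev clauseAt (cs : List Clause2) (j : ℕ) : Clause2 := cs.getD j ((0, true), (0, true))

theorem card_filter_getD {α : Type*} (l : List α) (d : α) (P : α → Bool) :
    ((Finset.range l.length).filter fun j => P (l.getD j d) = true).card = l.countP P := by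
  induction l using List.reverseRecOn with
  | nil => simp
  | append_singleton l a ih =>
    have h : ((Finset.range l.length).filter fun j => P ((l ++ [a]).getD j d) = true) =
        (Finset.range l.length).filter fun j => P (l.getD j d) = true := by
      refine Finset.filter_congr fun j hj => ?_
      rw [List.getD_append _ _ _ _ (Finset.mem_range.1 hj)]
    rw [List.length_append, List.length_singleton, Finset.range_add_one, Finset.filter_insert, h,
      List.countP_append, ← ih]
    have : (l ++ [a]).getD l.length d = a := by simp
    rw [this]
    cases h : P a <;> simp [h]

theorem lits_cons (c : Clause2) (cs : List Clause2) : lits (c :: cs) = c.1 :: c.2 :: lits cs := rfl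

theorem countP_mentions_le (cs : List Clause2) (i : ℕ) :
    cs.countP (fun c => c.1.1 == i || c.2.1 == i) ≤ (lits cs).countP (fun p => p.1 == i) := by
  induction cs with
  | nil => simp
  | cons c cs ih =>
    rw [lits_cons]
    simp only [List.countP_cons]
    grind

theorem countP_literals_le (cs : List Clause2) (i : ℕ) :
    cs.countP (fun c => c.1 == (i, true) || c.2 == (i, true)) +
      cs.countP (fun c => c.1 == (i, false) || c.2 == (i, false)) ≤
        (lits cs).countP (fun p => p.1 == i) := by
  induction cs with
  | nil => simp
  | cons c cs ih =>
    obtain ⟨⟨x, b⟩, ⟨y, b'⟩⟩ := c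
    rw [lits_cons]
    simp only [List.countP_cons]
    cases b <;> cases b' <;> by_cases hx : x = i <;> by_cases hy : y = i <;> simp [hx, hy] <;> omega

theorem exists_minor_polarity {n : ℕ} {cs : List Clause2} (hg : Good23 n cs) {i : ℕ} (h1 : 1 ≤ i)
    (h2 : i ≤ n) : ∃ b : Bool, ∀ j k, j < cs.length → k < cs.length →
      ((clauseAt cs j).1 = (i, b) ∨ (clauseAt cs j).2 = (i, b)) →
      ((clauseAt cs k).1 = (i, b) ∨ (clauseAt cs k).2 = (i, b)) → j = k := by
  have h3 := (hg.2 i h1 h2).2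
  have h4 := countP_literals_le cs i
  obtain ⟨b, hb⟩ : ∃ b, cs.countP (fun c => c.1 == (i, b) || c.2 == (i, b)) ≤ 1 := by
    by_cases h : cs.countP (fun c => c.1 == (i, true) || c.2 == (i, true)) ≤ 1
    · exact ⟨_, h⟩
    · exact ⟨false, by omega⟩
  refine ⟨b, fun j k hj hk hjb hkb => ?_⟩
  rw [← card_filter_getD cs ((0, true), (0, true)), Finset.card_le_one] at hb
  exact hb j (by simpa [hj] using hjb) k (by simpa [hk] using hkb)

theorem clauseAt_mem {cs : List Clause2} {j : ℕ} (hj : j < cs.length) : clauseAt cs j ∈ cs := by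
  rw [clauseAt, List.getD_eq_getElem _ _ hj]
  exact List.getElem_mem hj

theorem le_numP (n : ℕ) : 16 * n ≤ numP n := Nat.le_pow_clog one_lt_two _

theorem gv2_comm (n : ℕ) (cs : List Clause2) (a b r : ℕ) : gv2 n cs a b r = gv2 n cs b a r := by
  classical
  exact if_congr or_comm rfl (if_congr or_comm rfl (if_congr or_comm rfl rfl))

theorem gv2_of_oneGame {n : ℕ} {cs : List Clause2} {a b r : ℕ} (h : OneGame n cs a b) :
    gv2 n cs a b r = 1 := by
  simp [gv2, h]

theorem gv2_nonneg_of_zeroGame {n : ℕ} {cs : List Clause2} {a b r : ℕ} (h : ZeroGame n a b) :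
    0 ≤ gv2 n cs a b r := by
  unfold gv2
  simp only [h, true_or, if_true]
  split_ifs <;> simp

theorem gv2_nonneg_of_not_dxPlayer {n : ℕ} {cs : List Clause2} {a b r : ℕ} (ha : ¬ DXPlayer n a)
    (hb : ¬ DXPlayer n b) : 0 ≤ gv2 n cs a b r := by
  simp only [gv2, ha, hb, or_self, if_false]
  split_ifs <;> simp

theorem litPl_mem {n i : ℕ} (b : Bool) : litPl n (i, b) = xTPl n i ∨ litPl n (i, b) = xFPl n i := by
  cases b <;> simp [litPl]

theorem OneGame.cases {n : ℕ} {cs : List Clause2} (hg : Good23 n cs) {a b : ℕ}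
    (h : OneGame n cs a b) :
    (∃ i, 1 ≤ i ∧ i ≤ n ∧ a = xPl n i ∧ (b = xTPl n i ∨ b = xFPl n i)) ∨
      ∃ j < cs.length, a = cPl n (j + 1) ∧
        (b = litPl n (clauseAt cs j).1 ∨ b = litPl n (clauseAt cs j).2) ∧
        ∃ i, 1 ≤ i ∧ i ≤ n ∧ (b = xTPl n i ∨ b = xFPl n i) := by
  rcases h with h | ⟨j, hj, ha, hb⟩
  · exact .inl h
  · refine .inr ⟨j, hj, ha, hb, ?_⟩
    obtain ⟨h1, h2, h3, h4, -⟩ := hg.1 _ (clauseAt_mem hj)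
    rcases hb with rfl | rfl
    · exact ⟨_, h1, h2, litPl_mem _⟩
    · exact ⟨_, h3, h4, litPl_mem _⟩

/-- `a` is some `x_i` and `b` is `x_i^T` or `x_i^F`. -/
def VariableWin (n a b : ℕ) : Prop :=
  ∃ i, 1 ≤ i ∧ i ≤ n ∧ a = xPl n i ∧ (b = xTPl n i ∨ b = xFPl n i)

/-- `b` is a clause player and `a` is the player of one of its literals. -/
def ClauseWin (n : ℕ) (cs : List Clause2) (a b : ℕ) : Prop :=
  ∃ j < cs.length, b = cPl n (j + 1) ∧
    (a = litPl n (clauseAt cs j).1 ∨ a = litPl n (clauseAt cs j).2)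

theorem gv2_pos_cases {n : ℕ} {cs : List Clause2} (hg : Good23 n cs) {a b : ℕ} (hlt : b < a)
    (h : OneGame n cs a b ∨ OneGame n cs b a) : VariableWin n a b ∨ ClauseWin n cs a b := by
  have hN := le_numP n
  rcases h with h | h
  · rcases h.cases hg with h | ⟨j, hj, ha, -, i, h1, h2, hb⟩
    · exact .inl h
    · simp only [cPl, xTPl, xFPl] at ha hb
      omega
  · rcases h.cases hg with ⟨i, h1, h2, ha, hb⟩ | ⟨j, hj, ha, hb, -⟩
    · simp only [xPl, xTPl, xFPl] at ha hb
      omega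
    · exact .inr ⟨j, hj, ha, hb⟩

theorem OneGame.not_special {n : ℕ} {cs : List Clause2} (hg : Good23 n cs) {a b i : ℕ}
    (hi1 : 1 ≤ i) (hi : i ≤ n) (h : OneGame n cs a b) :
    a ≠ dMid n i ∧ b ≠ dMid n i ∧ b ≠ xPl n i ∧ (a = xPl n i → b < xPl n i) := by
  have hN := le_numP n
  simp only [dMid, xPl]
  rcases h.cases hg with ⟨k, h1, h2, ha, hb⟩ | ⟨j, hj, ha, -, k, h1, h2, hb⟩
  all_goals
    simp only [xPl, xTPl, xFPl, cPl] at ha hb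
    omega

theorem eq_dMid_of_gv2_ne {n : ℕ} {cs : List Clause2} (hg : Good23 n cs) {a i r : ℕ}
    (hi1 : 1 ≤ i) (hi : i ≤ n) (hlt : xPl n i < a) (h : gv2 n cs a (xPl n i) r ≠ -5) :
    a = dMid n i := by
  have hN := le_numP n
  have hx : DXPlayer n (xPl n i) := ⟨i, hi1, hi, .inr rfl⟩
  have h' : (OneGame n cs a (xPl n i) ∨ OneGame n cs (xPl n i) a) ∨
      (ZeroGame n a (xPl n i) ∨ ZeroGame n (xPl n i) a) := by
    by_contra hc
    push Not at hc
    exact h (by simp [gv2, hc, hx])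
  rcases h' with (h | h) | (h | h)
  · exact absurd rfl (h.not_special hg hi1 hi).2.2.1
  · exact absurd ((h.not_special hg hi1 hi).2.2.2 rfl) hlt.not_gt
  · obtain ⟨k, h1, h2, ha, hb⟩ := h
    simp only [dMid, dHat, dTil, xPl] at ha hb hlt ⊢
    omega
  · obtain ⟨k, h1, h2, ha, hb⟩ := h
    simp only [dMid, dHat, dTil, xPl] at ha hb hlt ⊢
    omega

theorem eq_dTil_or_xPl_of_gv2_ne {n : ℕ} {cs : List Clause2} (hg : Good23 n cs) {a i r : ℕ}
    (hi1 : 1 ≤ i) (hi : i ≤ n) (hlt : a < dMid n i) (h : gv2 n cs (dMid n i) a r ≠ -5) :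
    a = dTil n i ∨ a = xPl n i := by
  have hN := le_numP n
  have hx : DXPlayer n (dMid n i) := ⟨i, hi1, hi, .inl rfl⟩
  have h' : (OneGame n cs a (dMid n i) ∨ OneGame n cs (dMid n i) a) ∨
      (ZeroGame n a (dMid n i) ∨ ZeroGame n (dMid n i) a) := by
    by_contra hc
    push Not at hc
    exact h (by simp [gv2, hc, hx])
  rcases h' with (h | h) | (h | h)
  · exact absurd rfl (h.not_special hg hi1 hi).2.1
  · exact absurd rfl (h.not_special hg hi1 hi).1
  · obtain ⟨k, h1, h2, ha, hb⟩ := h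
    simp only [dMid, dHat, dTil, xPl] at ha hb hlt ⊢
    omega
  · obtain ⟨k, h1, h2, ha, hb⟩ := h
    simp only [dMid, dHat, dTil, xPl] at ha hb hlt ⊢
    omega

/-- Variable `i` is penalised if `x_i` loses, or `d_i` wins, a game of value `-5`. -/
def Penalised (n : ℕ) (cs : List Clause2) (β ρ : ℕ → ℕ) (i : ℕ) : Prop :=
  ∃ a ∈ (Finset.range (numP n)).erase (numP n - 1), gv2 n cs (β a) a (ρ a) = -5 ∧
    (a = xPl n i ∨ β a = dMid n i)

section UpperBound

variable {n : ℕ} {cs : List Clause2} {m : ℕ} {V : ℤ} {β ρ : ℕ → ℕ}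

theorem mem_losers {a : ℕ} :
    a ∈ (Finset.range (numP n)).erase (numP n - 1) ↔ a + 1 < numP n := by
  simp only [Finset.mem_erase, Finset.mem_range]
  omega

theorem Knockout.not_penalised (hn : 1 ≤ n) (hg : Good23 n cs)
    (k : Knockout (gv2 n cs) (Finset.range (numP n)) (numP n - 1) m V β ρ)
    {i : ℕ} (hi1 : 1 ≤ i) (hi : i ≤ n) (hp : ¬ Penalised n cs β ρ i) {y : ℕ}
    (hy : y + 1 < numP n) (hyx : β y = xPl n i) :
    (∀ c, c + 1 < numP n → β c ≠ y) ∧ ∀ z, z + 1 < numP n → β z = xPl n i → z = y := by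
  have hN := le_numP n
  have k1 : ∀ a, a + 1 < numP n → a < β a ∧ 1 ≤ ρ a ∧ ρ a < ρ (β a) := fun a ha =>
    (k.beats a (Finset.mem_range.2 (by omega)) (by omega)).2
  have k2 : ∀ a b, a + 1 < numP n → b + 1 < numP n → β a = β b → ρ a = ρ b → a = b :=
    fun a b ha hb => k.inj a (Finset.mem_range.2 (by omega)) b (Finset.mem_range.2 (by omega))
      (by omega) (by omega)
  have hp' : ∀ a, a + 1 < numP n → (a = xPl n i ∨ β a = dMid n i) →
      gv2 n cs (β a) a (ρ a) ≠ -5 := fun a ha h h' => hp ⟨a, mem_losers.2 ha, h', h⟩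
  have hx : xPl n i + 1 < numP n := by simp only [xPl]; omega
  have hxd : β (xPl n i) = dMid n i :=
    eq_dMid_of_gv2_ne hg hi1 hi (k1 _ hx).1 (hp' _ hx (.inl rfl))
  have hwin : ∀ a, a + 1 < numP n → β a = dMid n i → a = dTil n i ∨ a = xPl n i := by
    intro a ha h
    have h1 := (k1 a ha).1
    have h2 := hp' a ha (.inr h)
    rw [h] at h1 h2
    exact eq_dTil_or_xPl_of_gv2_ne hg hi1 hi h1 h2
  have hρ : ρ (xPl n i) ≤ 2 := by
    by_contra! hlt
    have hd := (k1 _ hx).2.2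
    rw [hxd] at hd
    have hdm : dMid n i ∈ Finset.range (numP n) := by
      simp only [dMid, Finset.mem_range]; omega
    have key : ∀ r, 1 ≤ r → r ≤ 2 → ∃ b, b + 1 < numP n ∧ β b = dMid n i ∧ ρ b = r ∧
        b = dTil n i := by
      intro r h1 h2
      obtain ⟨b, hb, hne, hβ, hr⟩ := k.surj _ hdm r h1 (by omega)
      have hb' := Finset.mem_range.1 hb
      refine ⟨b, by omega, hβ, hr, ?_⟩
      rcases hwin b (by omega) hβ with h | h
      · exact h
      · subst h; omega
    obtain ⟨b, -, -, hr, rfl⟩ := key 1 le_rfl one_le_two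
    obtain ⟨b, -, -, hr', rfl⟩ := key 2 one_le_two le_rfl
    omega
  have hone : ∀ z, z + 1 < numP n → β z = xPl n i → ρ z = 1 := by
    intro z hz h
    have := (k1 z hz).2
    rw [h] at this
    omega
  refine ⟨fun c hc h => ?_, fun z hz h => k2 z y hz hy (h.trans hyx.symm) ?_⟩
  · have := (k1 c hc).2
    rw [h, hone y hy hyx] at this
    omega
  · rw [hone y hy hyx, hone z hz h]

open Classical in
theorem card_penalised_le :
    ((Finset.Icc 1 n).filter (Penalised n cs β ρ)).card ≤
      2 * (((Finset.range (numP n)).erase (numP n - 1)).filter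
        fun a => gv2 n cs (β a) a (ρ a) = -5).card := by
  have hN := le_numP n
  set B := ((Finset.range (numP n)).erase (numP n - 1)).filter
        fun a => gv2 n cs (β a) a (ρ a) = -5 with hB
  have hsub : (Finset.Icc 1 n).filter (Penalised n cs β ρ) ⊆
      B.image (fun a => (numP n - a - 3 * n + 2) / 3) ∪
        B.image (fun a => (numP n - β a + 1) / 3) := by
    intro i hi
    obtain ⟨hi, a, ha, h5, h⟩ := Finset.mem_filter.1 hi
    have hi' := Finset.mem_Icc.1 hi
    have haB : a ∈ B := by rw [hB, Finset.mem_filter]; exact ⟨ha, h5⟩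
    rcases h with h | h
    · refine Finset.mem_union_left _ (Finset.mem_image.2 ⟨a, haB, ?_⟩)
      rw [h, xPl]; omega
    · refine Finset.mem_union_right _ (Finset.mem_image.2 ⟨a, haB, ?_⟩)
      rw [h, dMid]; omega
  calc _ ≤ _ := Finset.card_le_card hsub
    _ ≤ _ := Finset.card_union_le _ _
    _ ≤ B.card + B.card := add_le_add Finset.card_image_le Finset.card_image_le
    _ = _ := (two_mul _).symm

/-- `x_i` is not penalised and beats one of `x_i^T`, `x_i^F`. -/
def Decided (n : ℕ) (cs : List Clause2) (β ρ : ℕ → ℕ) (i : ℕ) : Prop :=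
  ¬ Penalised n cs β ρ i ∧ (β (xTPl n i) = xPl n i ∨ β (xFPl n i) = xPl n i)

open Classical in
theorem Knockout.card_variable_points_le (hn : 1 ≤ n) (hg : Good23 n cs)
    (k : Knockout (gv2 n cs) (Finset.range (numP n)) (numP n - 1) m V β ρ) :
    (((Finset.range (numP n)).erase (numP n - 1)).filter fun a =>
      VariableWin n (β a) a).card ≤
      2 * ((Finset.Icc 1 n).filter (Penalised n cs β ρ)).card +
        ((Finset.Icc 1 n).filter (Decided n cs β ρ)).card := by
  have hN := le_numP n
  set P := (Finset.Icc 1 n).filter (Penalised n cs β ρ) with hP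
  set D := (Finset.Icc 1 n).filter (Decided n cs β ρ) with hD
  have hsub : (((Finset.range (numP n)).erase (numP n - 1)).filter fun a =>
      VariableWin n (β a) a) ⊆
      (P.image (xTPl n) ∪ P.image (xFPl n)) ∪
        D.image fun i => if β (xTPl n i) = xPl n i then xTPl n i else xFPl n i := by
    intro a ha
    obtain ⟨ha, i, h1, h2, h3, h4⟩ := Finset.mem_filter.1 ha
    have ha' := mem_losers.1 ha
    have hi : i ∈ Finset.Icc 1 n := Finset.mem_Icc.2 ⟨h1, h2⟩
    by_cases hp : Penalised n cs β ρ i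
    · have hiP : i ∈ P := by rw [hP, Finset.mem_filter]; exact ⟨hi, hp⟩
      refine Finset.mem_union_left _ ?_
      rcases h4 with rfl | rfl
      · exact Finset.mem_union_left _ (Finset.mem_image_of_mem _ hiP)
      · exact Finset.mem_union_right _ (Finset.mem_image_of_mem _ hiP)
    · have hiD : i ∈ D := by
        rw [hD, Finset.mem_filter]
        refine ⟨hi, hp, ?_⟩
        rcases h4 with rfl | rfl
        · exact .inl h3
        · exact .inr h3
      refine Finset.mem_union_right _ (Finset.mem_image.2 ⟨i, hiD, ?_⟩)
      rcases h4 with rfl | rfl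
      · simp [h3]
      · split_ifs with h
        · exact (k.not_penalised hn hg h1 h2 hp ha' h3).2 _ (by simp only [xTPl]; omega) h
        · rfl
  calc _ ≤ _ := Finset.card_le_card hsub
    _ ≤ _ := Finset.card_union_le _ _
    _ ≤ _ := add_le_add ((Finset.card_union_le _ _).trans
      (add_le_add Finset.card_image_le Finset.card_image_le)) Finset.card_image_le
    _ = _ := by rw [two_mul]

open Classical in
theorem Knockout.card_clause_points_le (hn : 1 ≤ n) (hg : Good23 n cs) {M : ℕ}
    (hM : ∀ α, satCount α cs ≤ M)
    (k : Knockout (gv2 n cs) (Finset.range (numP n)) (numP n - 1) m V β ρ) :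
    (((Finset.range (numP n)).erase (numP n - 1)).filter fun a =>
      ClauseWin n cs (β a) a).card +
        ((Finset.Icc 1 n).filter (Decided n cs β ρ)).card ≤ M + n := by
  have hN := le_numP n
  have hminor : ∀ i : ℕ, ∃ b : Bool, 1 ≤ i → i ≤ n → ∀ j k, j < cs.length → k < cs.length →
      ((clauseAt cs j).1 = (i, b) ∨ (clauseAt cs j).2 = (i, b)) →
      ((clauseAt cs k).1 = (i, b) ∨ (clauseAt cs k).2 = (i, b)) → j = k := by
    intro i
    by_cases h : 1 ≤ i ∧ i ≤ n
    · obtain ⟨b, hb⟩ := exists_minor_polarity hg h.1 h.2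
      exact ⟨b, fun _ _ => hb⟩
    · exact ⟨true, fun h1 h2 => absurd ⟨h1, h2⟩ h⟩
  choose minor hminor using hminor
  let α : ℕ → Bool := fun i =>
    if Decided n cs β ρ i then decide (β (xFPl n i) = xPl n i) else !minor i
  set J := (Finset.range cs.length).filter fun j =>
    β (cPl n (j + 1)) = litPl n (clauseAt cs j).1 ∨
      β (cPl n (j + 1)) = litPl n (clauseAt cs j).2 with hJ
  have h1 : (((Finset.range (numP n)).erase (numP n - 1)).filter fun a =>
      ClauseWin n cs (β a) a).card ≤ J.card := by
    refine (Finset.card_le_card ?_).trans (Finset.card_image_le (f := fun j => cPl n (j + 1)))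
    intro a ha
    obtain ⟨-, j, hj, rfl, h⟩ := Finset.mem_filter.1 ha
    refine Finset.mem_image.2 ⟨j, ?_, rfl⟩
    rw [hJ, Finset.mem_filter]
    exact ⟨Finset.mem_range.2 hj, h⟩
  have h2 : (J.filter fun j => clauseSat α (clauseAt cs j) = true).card ≤ M := by
    refine le_trans ?_ (hM α)
    rw [satCount, ← card_filter_getD cs ((0, true), (0, true))]
    exact Finset.card_le_card (Finset.filter_subset_filter _ (Finset.filter_subset _ _))
  have h3 : (J.filter fun j => ¬ clauseSat α (clauseAt cs j) = true).card ≤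
      ((Finset.Icc 1 n).filter fun i => ¬ Decided n cs β ρ i).card := by
    have key : ∀ j ∈ J.filter fun j => ¬ clauseSat α (clauseAt cs j) = true,
        ∃ i, 1 ≤ i ∧ i ≤ n ∧ ¬ Decided n cs β ρ i ∧
          ((clauseAt cs j).1 = (i, minor i) ∨ (clauseAt cs j).2 = (i, minor i)) := by
      intro j hj
      obtain ⟨hjJ, hsat⟩ := Finset.mem_filter.1 hj
      rw [hJ, Finset.mem_filter, Finset.mem_range] at hjJ
      obtain ⟨hjm, hβ⟩ := hjJ
      obtain ⟨g1, g2, g3, g4, -⟩ := hg.1 _ (clauseAt_mem hjm)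
      simp only [clauseSat, Bool.or_eq_true, beq_iff_eq, not_or] at hsat
      obtain ⟨⟨i, b⟩, hp, hi1, hi, hβ, hα⟩ : ∃ p : ℕ × Bool,
          ((clauseAt cs j).1 = p ∨ (clauseAt cs j).2 = p) ∧ 1 ≤ p.1 ∧ p.1 ≤ n ∧
            β (cPl n (j + 1)) = litPl n p ∧ α p.1 ≠ p.2 := by
        rcases hβ with h | h
        · exact ⟨_, .inl rfl, g1, g2, h, hsat.1⟩
        · exact ⟨_, .inr rfl, g3, g4, h, hsat.2⟩
      simp only at hi1 hi hα
      have hnd : ¬ Decided n cs β ρ i := by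
        intro hd
        have hc : cPl n (j + 1) + 1 < numP n := by simp only [cPl]; omega
        have hT : xTPl n i + 1 < numP n := by simp only [xTPl]; omega
        have hF : xFPl n i + 1 < numP n := by simp only [xFPl]; omega
        have hTF : xTPl n i ≠ xFPl n i := by simp only [xTPl, xFPl]; omega
        have hn := fun y => k.not_penalised hn hg hi1 hi hd.1 (y := y)
        simp only [α, if_pos hd] at hα
        cases b
        · simp only [ne_eq, decide_eq_false_iff_not, not_not] at hα
          exact (hn _ hF hα).1 _ hc hβ
        · simp only [ne_eq, decide_eq_true_eq] at hα
          exact (hn _ hT (hd.2.resolve_right hα)).1 _ hc hβ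
      refine ⟨i, hi1, hi, hnd, ?_⟩
      have : b = minor i := by
        rw [show α i = !minor i from if_neg hnd] at hα
        revert hα
        cases b <;> cases minor i <;> decide
      rwa [← this]
    choose! f hf using key
    refine Finset.card_le_card_of_injOn f (fun j hj => ?_) (fun j hj l hl h => ?_)
    · obtain ⟨a1, a2, a3, -⟩ := hf j hj
      exact Finset.mem_coe.2 (Finset.mem_filter.2 ⟨Finset.mem_Icc.2 ⟨a1, a2⟩, a3⟩)
    · obtain ⟨a1, a2, -, a3⟩ := hf j hj
      obtain ⟨-, -, -, b3⟩ := hf l hl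
      rw [← h] at b3
      have hlt : ∀ j ∈ J.filter fun j => ¬ clauseSat α (clauseAt cs j) = true, j < cs.length :=
        fun j hj => Finset.mem_range.1 (Finset.mem_filter.1 (Finset.mem_filter.1 hj).1).1
      exact hminor (f j) a1 a2 j l (hlt j hj) (hlt l hl) a3 b3
  have h4 := Finset.card_filter_add_card_filter_not (s := J)
    fun j => clauseSat α (clauseAt cs j) = true
  have h5 := Finset.card_filter_add_card_filter_not (s := Finset.Icc 1 n) (Decided n cs β ρ)
  rw [Nat.card_Icc] at h5
  omega

theorem Knockout.value_le (hn : 1 ≤ n) (hg : Good23 n cs) {M : ℕ} (hM : ∀ α, satCount α cs ≤ M)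
    (k : Knockout (gv2 n cs) (Finset.range (numP n)) (numP n - 1) m V β ρ) : V ≤ M + n := by
  classical
  have h1 := card_penalised_le (n := n) (cs := cs) (β := β) (ρ := ρ)
  have h2 := k.card_variable_points_le hn hg
  have h3 := k.card_clause_points_le hn hg hM
  set S := (Finset.range (numP n)).erase (numP n - 1) with hS
  have hle : ∀ a ∈ S, gv2 n cs (β a) a (ρ a) ≤ (if VariableWin n (β a) a then 1 else 0) +
      (if ClauseWin n cs (β a) a then 1 else 0) -
      5 * if gv2 n cs (β a) a (ρ a) = -5 then 1 else 0 := by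
    intro a ha
    have hlt := (k.beats a (Finset.mem_of_mem_erase ha) (Finset.ne_of_mem_erase ha)).2.1
    have hX : (0 : ℤ) ≤ if VariableWin n (β a) a then 1 else 0 := by positivity
    have hC : (0 : ℤ) ≤ if ClauseWin n cs (β a) a then 1 else 0 := by positivity
    by_cases h1 : OneGame n cs (β a) a ∨ OneGame n cs a (β a)
    · have hv : gv2 n cs (β a) a (ρ a) = 1 := by simp [gv2, h1]
      have hw := gv2_pos_cases hg hlt h1
      rw [hv, if_neg (show ¬ (1 : ℤ) = -5 by decide)]
      rcases hw with h | h
      · rw [if_pos h]; linarith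
      · rw [if_pos h]; linarith
    · have hv : gv2 n cs (β a) a (ρ a) = 0 ∨ gv2 n cs (β a) a (ρ a) = -5 := by
        simp only [gv2, h1, if_false]
        split_ifs <;> simp
      rcases hv with hv | hv
      · rw [hv, if_neg (show ¬ (0 : ℤ) = -5 by decide)]; linarith
      · rw [hv, if_pos rfl]; linarith
  have hsum := Finset.sum_le_sum hle
  rw [← k.value, Finset.sum_sub_distrib, Finset.sum_add_distrib, ← Finset.mul_sum,
    Finset.sum_boole, Finset.sum_boole, Finset.sum_boole] at hsum
  omega

end UpperBound

theorem not_dxPlayer_dHat {n i : ℕ} (hi1 : 1 ≤ i) (hi : i ≤ n) : ¬ DXPlayer n (dHat n i) := by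
  have hN := le_numP n
  rintro ⟨k, h1, h2, h⟩
  simp only [dHat, dMid, xPl] at h
  omega

theorem not_dxPlayer_litPl {n i : ℕ} (hi1 : 1 ≤ i) (hi : i ≤ n) (b : Bool) :
    ¬ DXPlayer n (litPl n (i, b)) := by
  have hN := le_numP n
  rintro ⟨k, h1, h2, h⟩
  rcases litPl_mem (n := n) (i := i) b with h' | h' <;> rw [h'] at h <;>
    simp only [xTPl, xFPl, dMid, xPl] at h <;> omega

theorem not_dxPlayer_of_lt {n a : ℕ} (h : a < numP n - 6 * n) : ¬ DXPlayer n a := by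
  rintro ⟨k, h1, h2, h⟩
  simp only [dMid, xPl] at h
  omega

theorem length_ne_zero_of_pow {l : List ℕ} {k : ℕ} (h : l.length = 2 ^ k) : l ≠ [] := by
  rintro rfl
  have : 0 < 2 ^ k := by positivity
  rw [List.length_nil] at h
  omega

theorem tourValue_nonneg {v : ℕ → ℕ → ℕ → ℤ} {P : ℕ → Prop}
    (hv : ∀ a b r, P a → P b → 0 ≤ v a b r) (k : ℕ) :
    ∀ l : List ℕ, l.length = 2 ^ k → (∀ a ∈ l, P a) → 0 ≤ tourValue v k l := by
  induction k with
  | zero => intro l _ _; rfl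
  | succ k ih =>
    intro l hl hP
    have h1 : (l.take (2 ^ k)).length = 2 ^ k := by simp [hl, pow_succ]
    have h2 : (l.drop (2 ^ k)).length = 2 ^ k := by
      rw [List.length_drop, hl, pow_succ]; omega
    have p1 : ∀ a ∈ l.take (2 ^ k), P a := fun a ha => hP a (List.mem_of_mem_take ha)
    have p2 : ∀ a ∈ l.drop (2 ^ k), P a := fun a ha => hP a (List.mem_of_mem_drop ha)
    exact add_nonneg (add_nonneg (ih _ h1 p1) (ih _ h2 p2)) <|
      hv _ _ _ (p1 _ (winner_mem (length_ne_zero_of_pow h1)))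
        (p2 _ (winner_mem (length_ne_zero_of_pow h2)))

/-- Seeding `l` in a `k`-round tournament gives the winner `w` and value at least `V`. -/
def Achieves (v : ℕ → ℕ → ℕ → ℤ) (k : ℕ) (l : List ℕ) (w : ℕ) (V : ℤ) : Prop :=
  l.length = 2 ^ k ∧ winner l = w ∧ V ≤ tourValue v k l

theorem Achieves.singleton (v : ℕ → ℕ → ℕ → ℤ) (a : ℕ) : Achieves v 0 [a] a 0 :=
  ⟨rfl, by simp [winner], le_rfl⟩

theorem Achieves.append {v : ℕ → ℕ → ℕ → ℤ} {k : ℕ} {l₁ l₂ : List ℕ} {w₁ w₂ : ℕ} {V₁ V₂ u : ℤ}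
    (h₁ : Achieves v k l₁ w₁ V₁) (h₂ : Achieves v k l₂ w₂ V₂) (hw : w₂ ≤ w₁)
    (hu : u ≤ v w₁ w₂ (k + 1)) : Achieves v (k + 1) (l₁ ++ l₂) w₁ (V₁ + V₂ + u) := by
  obtain ⟨a₁, b₁, c₁⟩ := h₁
  obtain ⟨a₂, b₂, c₂⟩ := h₂
  refine ⟨by rw [List.length_append, a₁, a₂, pow_succ, mul_two], ?_, ?_⟩
  · rw [winner_append, b₁, b₂, max_eq_left hw]
  · rw [tourValue_append v a₁, b₁, b₂]
    linarith

theorem winner_cons_of_le {c : ℕ} {l : List ℕ} (h : ∀ a ∈ l, a ≤ c) : winner (c :: l) = c := by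
  refine le_antisymm ?_ (le_winner List.mem_cons_self)
  rcases List.mem_cons.1 (winner_mem (List.cons_ne_nil c l)) with h' | h'
  · exact h'.le
  · exact h _ h'

section LowerBound

variable {n : ℕ} {cs : List Clause2} {K : ℕ}

/-- `c` is either a clause player worth at least `s` to `y`, or a dummy player (below `K`). -/
def Slot (n : ℕ) (cs : List Clause2) (K y c : ℕ) (s : ℤ) : Prop :=
  c < numP n - 6 * n ∧ ((K ≤ c ∧ ∀ r, s ≤ gv2 n cs y c r) ∨ (c < K ∧ s = 0))

theorem Slot.achieves (hK : K ≤ numP n - 6 * n) {y c k : ℕ} {s : ℤ} (hy : ¬ DXPlayer n y)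
    (h : Slot n cs K y c s) {l : List ℕ} (hl : l.length + 1 = 2 ^ k) (hlK : ∀ a ∈ l, a < K) :
    ∃ w, w < numP n - 6 * n ∧ Achieves (gv2 n cs) k (c :: l) w 0 ∧ ∀ r, s ≤ gv2 n cs y w r := by
  have hlow : ∀ a ∈ c :: l, a < numP n - 6 * n := by
    intro a ha
    rcases List.mem_cons.1 ha with rfl | ha
    · exact h.1
    · exact (hlK a ha).trans_le hK
  have hw := hlow _ (winner_mem (List.cons_ne_nil c l))
  refine ⟨winner (c :: l), hw, ⟨hl, rfl, ?_⟩, fun r => ?_⟩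
  · exact tourValue_nonneg (P := fun a => ¬ DXPlayer n a)
      (fun a b r => gv2_nonneg_of_not_dxPlayer) k _ hl fun a ha => not_dxPlayer_of_lt (hlow a ha)
  · rcases h.2 with ⟨h1, h2⟩ | ⟨-, rfl⟩
    · rw [winner_cons_of_le fun a ha => ((hlK a ha).trans_le h1).le]
      exact h2 r
    · exact gv2_nonneg_of_not_dxPlayer hy (not_dxPlayer_of_lt hw)

theorem achieves_block (hK : K ≤ numP n - 6 * n) {i : ℕ} (hi1 : 1 ≤ i) (hi : i ≤ n) (b : Bool)
    {c₁ c₂ c₃ : ℕ} {s₁ s₂ s₃ : ℤ} (h₁ : Slot n cs K (litPl n (i, b)) c₁ s₁)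
    (h₂ : Slot n cs K (litPl n (i, b)) c₂ s₂) (h₃ : Slot n cs K (litPl n (i, b)) c₃ s₃)
    {f₁ f₂ f₃ f₄ f₅ f₆ f₇ : ℕ} (hf : ∀ f ∈ [f₁, f₂, f₃, f₄, f₅, f₆, f₇], f < K) :
    Achieves (gv2 n cs) 4
      ([dHat n i, f₁, f₂, f₃, dMid n i, dTil n i, xPl n i, litPl n (i, !b)] ++
        [litPl n (i, b), c₁, c₂, f₄, c₃, f₅, f₆, f₇]) (dHat n i) (1 + (s₁ + s₂ + s₃)) := by
  have hN := le_numP n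
  have hlit : ∀ b, numP n - 6 * n ≤ litPl n (i, b) ∧ litPl n (i, b) < xPl n i := by
    intro b
    rcases litPl_mem (n := n) (i := i) b with h | h <;> rw [h] <;>
      simp only [xTPl, xFPl, xPl] <;> omega
  have hd : xPl n i < dTil n i ∧ dTil n i < dMid n i ∧ dMid n i < dHat n i := by
    simp only [dHat, dMid, dTil, xPl]; omega
  have hy := not_dxPlayer_litPl hi1 hi b
  have hdh := not_dxPlayer_dHat hi1 hi
  have hb := hlit b
  have hb' := hlit !b
  simp only [List.mem_cons, List.not_mem_nil, or_false, forall_eq_or_imp, forall_eq] at hf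
  obtain ⟨g1, g2, g3, g4, g5, g6, g7⟩ := hf
  have e1 : Achieves (gv2 n cs) 2 [dHat n i, f₁, f₂, f₃] (dHat n i) 0 := by
    have hle : ∀ a ∈ [f₁, f₂, f₃], a < numP n - 6 * n := by
      simp only [List.mem_cons, List.not_mem_nil, or_false, forall_eq_or_imp, forall_eq]
      omega
    refine ⟨rfl, winner_cons_of_le fun a ha => by have := hle a ha; omega, ?_⟩
    refine tourValue_nonneg (P := fun a => ¬ DXPlayer n a)
      (fun a b r => gv2_nonneg_of_not_dxPlayer) 2 _ rfl fun a ha => ?_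
    rcases List.mem_cons.1 ha with rfl | ha
    · exact hdh
    · exact not_dxPlayer_of_lt (hle a ha)
  have e2 := (Achieves.singleton (gv2 n cs) (dMid n i)).append
    (Achieves.singleton (gv2 n cs) (dTil n i)) hd.2.1.le
    (gv2_nonneg_of_zeroGame ⟨i, hi1, hi, rfl, .inr (.inl rfl)⟩)
  have e3 := (Achieves.singleton (gv2 n cs) (xPl n i)).append
    (Achieves.singleton (gv2 n cs) (litPl n (i, !b))) hb'.2.le
    (gv2_of_oneGame (.inl ⟨i, hi1, hi, rfl, litPl_mem _⟩)).ge
  have e4 := e1.append (e2.append e3 (by omega)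
    (gv2_nonneg_of_zeroGame ⟨i, hi1, hi, rfl, .inr (.inr rfl)⟩)) (u := 0) (by omega)
    (by rw [gv2_comm]; exact gv2_nonneg_of_zeroGame ⟨i, hi1, hi, rfl, .inl rfl⟩)
  obtain ⟨w1, l1, a1, v1⟩ := h₁.achieves hK hy (k := 0) (l := []) rfl (by simp)
  obtain ⟨w2, l2, a2, v2⟩ := h₂.achieves hK hy (k := 1) (l := [f₄]) rfl (by simpa)
  obtain ⟨w3, l3, a3, v3⟩ := h₃.achieves hK hy (k := 2) (l := [f₅, f₆, f₇]) rfl (by simp [*])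
  have e5 := (((Achieves.singleton (gv2 n cs) (litPl n (i, b))).append a1 (by omega) (v1 _)).append
    a2 (by omega) (v2 _)).append a3 (by omega) (v3 _)
  obtain ⟨q1, q2, q3⟩ := e4.append e5 (by omega) (gv2_nonneg_of_not_dxPlayer hdh hy)
  exact ⟨q1, q2, by simpa [add_assoc] using q3⟩

/-- The variable and special players belonging to variable `i`. -/
def variablePlayers (n i : ℕ) : List ℕ :=
  [dHat n i, dMid n i, dTil n i, xPl n i, xTPl n i, xFPl n i]

theorem exists_variable_block (hK : K ≤ numP n - 6 * n) {i : ℕ} (hi1 : 1 ≤ i) (hi : i ≤ n)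
    (b : Bool) {s : ℕ → ℤ} {S F : List ℕ} (hS : S.length ≤ 3)
    (hsS : ∀ c ∈ S, Slot n cs K (litPl n (i, b)) c (s c)) (hF : F.length = 10 - S.length)
    (hFK : ∀ f ∈ F, f < K) :
    ∃ l, Achieves (gv2 n cs) 4 l (dHat n i) (1 + (S.map s).sum) ∧
      l.Perm (variablePlayers n i ++ S ++ F) := by
  have hperm : ∀ c₁ c₂ c₃ f₁ f₂ f₃ f₄ f₅ f₆ f₇ : ℕ,
      ([dHat n i, f₁, f₂, f₃, dMid n i, dTil n i, xPl n i, litPl n (i, !b)] ++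
        [litPl n (i, b), c₁, c₂, f₄, c₃, f₅, f₆, f₇]).Perm
        (variablePlayers n i ++ [c₁, c₂, c₃, f₁, f₂, f₃, f₄, f₅, f₆, f₇]) := by
    intros
    rw [List.perm_iff_count]
    intro a
    cases b <;> simp only [variablePlayers, litPl, List.count_cons, List.cons_append,
      List.nil_append, Bool.not_true, Bool.not_false, if_true, if_false, Bool.false_eq_true] <;>
      omega
  have hdummy : ∀ f ∈ F, Slot n cs K (litPl n (i, b)) f 0 := fun f hf =>
    ⟨(hFK f hf).trans_le hK, .inr ⟨hFK f hf, rfl⟩⟩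
  rw [List.append_assoc]
  match S, F, hF with
  | [], [c₁, c₂, c₃, f₁, f₂, f₃, f₄, f₅, f₆, f₇], _ =>
    obtain ⟨p1, p2, p3⟩ := achieves_block hK hi1 hi b (hdummy c₁ (by simp))
      (hdummy c₂ (by simp)) (hdummy c₃ (by simp)) fun f hf =>
      hFK f (.tail _ (.tail _ (.tail _ hf)))
    exact ⟨_, ⟨p1, p2, by simpa [add_assoc] using p3⟩, hperm c₁ c₂ c₃ f₁ f₂ f₃ f₄ f₅ f₆ f₇⟩
  | [c₁], [c₂, c₃, f₁, f₂, f₃, f₄, f₅, f₆, f₇], _ =>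
    obtain ⟨p1, p2, p3⟩ := achieves_block hK hi1 hi b (hsS c₁ (by simp))
      (hdummy c₂ (by simp)) (hdummy c₃ (by simp)) fun f hf =>
      hFK f (.tail _ (.tail _ hf))
    exact ⟨_, ⟨p1, p2, by simpa [add_assoc] using p3⟩, hperm c₁ c₂ c₃ f₁ f₂ f₃ f₄ f₅ f₆ f₇⟩
  | [c₁, c₂], [c₃, f₁, f₂, f₃, f₄, f₅, f₆, f₇], _ =>
    obtain ⟨p1, p2, p3⟩ := achieves_block hK hi1 hi b (hsS c₁ (by simp))
      (hsS c₂ (by simp)) (hdummy c₃ (by simp)) fun f hf =>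
      hFK f (.tail _ hf)
    exact ⟨_, ⟨p1, p2, by simpa [add_assoc] using p3⟩, hperm c₁ c₂ c₃ f₁ f₂ f₃ f₄ f₅ f₆ f₇⟩
  | [c₁, c₂, c₃], [f₁, f₂, f₃, f₄, f₅, f₆, f₇], _ =>
    obtain ⟨p1, p2, p3⟩ := achieves_block hK hi1 hi b (hsS c₁ (by simp))
      (hsS c₂ (by simp)) (hsS c₃ (by simp)) hFK
    exact ⟨_, ⟨p1, p2, by simpa [add_assoc] using p3⟩, hperm c₁ c₂ c₃ f₁ f₂ f₃ f₄ f₅ f₆ f₇⟩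
  | _ :: _ :: _ :: _ :: _, _, _ => simp only [List.length_cons] at hS; omega

theorem exists_variable_blocks (hK : K ≤ numP n - 6 * n) {α : ℕ → Bool} {s : ℕ → ℤ}
    {S : ℕ → List ℕ} (hS : ∀ i, 1 ≤ i → i ≤ n → (S i).length ≤ 3)
    (hsS : ∀ i, ∀ c ∈ S i, Slot n cs K (litPl n (i, α i)) c (s c)) (is : List ℕ) :
    ∀ F : List ℕ, (∀ i ∈ is, 1 ≤ i ∧ i ≤ n) →
      F.length + (is.flatMap S).length = 10 * is.length → (∀ f ∈ F, f < K) →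
      ∃ B : List (List ℕ), B.length = is.length ∧
        (∀ l ∈ B, l.length = 16 ∧ ¬ DXPlayer n (winner l)) ∧
        B.flatten.Perm (is.flatMap (variablePlayers n) ++ is.flatMap S ++ F) ∧
        is.length + ((is.flatMap S).map s).sum ≤ (B.map (tourValue (gv2 n cs) 4)).sum := by
  induction is with
  | nil =>
    intro F _ hF _
    have : F = [] := List.length_eq_zero_iff.1 (by simpa using hF)
    exact ⟨[], by simp [this]⟩
  | cons i is ih =>
    intro F his hF hFK
    obtain ⟨hi1, hi⟩ := his i List.mem_cons_self
    have h3 := hS i hi1 hi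
    have his' : ∀ i ∈ is, 1 ≤ i ∧ i ≤ n := fun j hj => his j (List.mem_cons_of_mem _ hj)
    have hle : (is.flatMap S).length ≤ 3 * is.length := by
      clear ih hF his
      induction is with
      | nil => simp
      | cons j is ih =>
        have := hS j (his' j List.mem_cons_self).1 (his' j List.mem_cons_self).2
        have := ih fun k hk => his' k (List.mem_cons_of_mem _ hk)
        simp only [List.flatMap_cons, List.length_append, List.length_cons]
        omega
    rw [List.flatMap_cons, List.length_append, List.length_cons] at hF
    obtain ⟨F₁, F₂, rfl, h₁⟩ : ∃ F₁ F₂, F = F₁ ++ F₂ ∧ F₁.length = 10 - (S i).length :=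
      ⟨F.take (10 - (S i).length), F.drop (10 - (S i).length), by simp, by
        rw [List.length_take]; omega⟩
    rw [List.length_append] at hF
    obtain ⟨B, b1, b2, b3, b4⟩ := ih F₂ his' (by omega)
      fun f hf => hFK f (List.mem_append_right _ hf)
    obtain ⟨l, ⟨l1, l2, l3⟩, l4⟩ := exists_variable_block hK hi1 hi (α i) h3 (hsS i) h₁
      fun f hf => hFK f (List.mem_append_left _ hf)
    refine ⟨l :: B, by simp [b1], ?_, ?_, ?_⟩
    · intro l' hl'
      rcases List.mem_cons.1 hl' with rfl | hl'
      · exact ⟨l1, l2 ▸ not_dxPlayer_dHat hi1 hi⟩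
      · exact b2 _ hl'
    · rw [List.flatten_cons]
      refine (l4.append b3).trans (List.perm_iff_count.2 fun a => ?_)
      simp only [List.count_append, List.flatMap_cons]
      omega
    · simp only [List.map_cons, List.sum_cons, List.flatMap_cons, List.map_append,
        List.sum_append, List.length_cons]
      push_cast
      linarith

theorem exists_dummy_blocks (hK : K ≤ numP n - 6 * n) (q : ℕ) :
    ∀ F : List ℕ, F.length = 16 * q → (∀ f ∈ F, f < K) →
      ∃ B : List (List ℕ), B.length = q ∧
        (∀ l ∈ B, l.length = 16 ∧ ¬ DXPlayer n (winner l)) ∧ B.flatten = F ∧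
        0 ≤ (B.map (tourValue (gv2 n cs) 4)).sum := by
  induction q with
  | zero =>
    intro F hF _
    exact ⟨[], by simp_all⟩
  | succ q ih =>
    intro F hF hFK
    obtain ⟨B, b1, b2, b3, b4⟩ := ih (F.drop 16) (by rw [List.length_drop]; omega)
      fun f hf => hFK f (List.mem_of_mem_drop hf)
    have hlen : (F.take 16).length = 16 := by rw [List.length_take]; omega
    have hdx : ∀ f ∈ F.take 16, ¬ DXPlayer n f := fun f hf =>
      not_dxPlayer_of_lt ((hFK f (List.mem_of_mem_take hf)).trans_le hK)
    refine ⟨F.take 16 :: B, by simp [b1], ?_, by simp [b3], ?_⟩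
    · intro l hl
      rcases List.mem_cons.1 hl with rfl | hl
      · exact ⟨hlen, hdx _ (winner_mem (length_ne_zero_of_pow (k := 4) hlen))⟩
      · exact b2 _ hl
    · rw [List.map_cons, List.sum_cons]
      exact add_nonneg (tourValue_nonneg (P := fun a => ¬ DXPlayer n a)
        (fun a b r => gv2_nonneg_of_not_dxPlayer) 4 _ hlen hdx) b4

theorem sum_blocks_le_tourValue (j : ℕ) : ∀ B : List (List ℕ), B.length = 2 ^ j →
    (∀ l ∈ B, l.length = 16 ∧ ¬ DXPlayer n (winner l)) →
    B.flatten.length = 2 ^ (4 + j) ∧ ¬ DXPlayer n (winner B.flatten) ∧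
      (B.map (tourValue (gv2 n cs) 4)).sum ≤ tourValue (gv2 n cs) (4 + j) B.flatten := by
  induction j with
  | zero =>
    intro B hB h
    obtain ⟨l, rfl⟩ := List.length_eq_one_iff.1 hB
    simpa using h
  | succ j ih =>
    intro B hB h
    obtain ⟨B₁, B₂, rfl, h₁⟩ : ∃ B₁ B₂, B = B₁ ++ B₂ ∧ B₁.length = 2 ^ j :=
      ⟨B.take (2 ^ j), B.drop (2 ^ j), by simp, by simp [hB, pow_succ]⟩
    have h₂ : B₂.length = 2 ^ j := by
      rw [List.length_append, pow_succ] at hB; omega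
    obtain ⟨p1, p2, p3⟩ := ih B₁ h₁ fun l hl => h l (List.mem_append_left _ hl)
    obtain ⟨q1, q2, q3⟩ := ih B₂ h₂ fun l hl => h l (List.mem_append_right _ hl)
    rw [List.flatten_append, ← add_assoc]
    refine ⟨by rw [List.length_append, p1, q1, pow_succ, mul_two], ?_, ?_⟩
    · rw [winner_append]
      rcases max_choice (winner B₁.flatten) (winner B₂.flatten) with hm | hm <;> rw [hm]
      · exact p2
      · exact q2
    · rw [tourValue_append _ p1, List.map_append, List.sum_append]
      have := gv2_nonneg_of_not_dxPlayer (cs := cs) (r := 4 + j + 1) p2 q2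
      linarith

theorem isSeeding_of_perm {P : ℕ} {l l' : List ℕ} (h : l.Perm l') (hlen : l'.length = P)
    (hmem : ∀ a < P, a ∈ l') : IsSeeding (Finset.range P) l := by
  have hsub : Finset.range P ⊆ l.toFinset := fun a ha =>
    List.mem_toFinset.2 (h.mem_iff.2 (hmem a (Finset.mem_range.1 ha)))
  have hl : l.length = P := h.length_eq.trans hlen
  have heq : Finset.range P = l.toFinset := Finset.eq_of_subset_of_card_le hsub
    (by rw [Finset.card_range, ← hl]; exact l.toFinset_card_le)
  refine ⟨?_, heq.symm⟩
  rw [← Multiset.coe_nodup, ← Multiset.toFinset_card_eq_card_iff_nodup, List.toFinset_coe,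
    Multiset.coe_card, ← heq, Finset.card_range, hl]

theorem perm_flatMap_filter {L is : List ℕ} (hL : L.Nodup) (his : is.Nodup) {g : ℕ → ℕ}
    (hg : ∀ j ∈ L, g j ∈ is) : (is.flatMap fun i => L.filter fun j => g j == i).Perm L := by
  refine (List.perm_ext_iff_of_nodup ?_ hL).2 fun j => ?_
  · refine List.nodup_flatMap.2 ⟨fun i _ => hL.filter _, his.imp fun {i k} hik => ?_⟩
    intro j hj hj'
    simp only [List.mem_filter, beq_iff_eq] at hj hj'
    exact hik (hj.2.symm.trans hj'.2)
  · simp only [List.mem_flatMap, List.mem_filter, beq_iff_eq]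
    exact ⟨fun ⟨_, _, h, _⟩ => h, fun h => ⟨_, hg j h, h, rfl⟩⟩

end LowerBound

theorem exists_seeding_ge {n : ℕ} {cs : List Clause2} (hn : 1 ≤ n) (hg : Good23 n cs)
    (α : ℕ → Bool) : ∃ l, IsSeeding (Finset.range (numP n)) l ∧
      (satCount α cs : ℤ) + n ≤ tourValue (gv2 n cs) (Nat.clog 2 (16 * n)) l := by
  classical
  set L := List.range cs.length with hL
  set is := List.range' 1 n with his
  have hmemL : ∀ j, j ∈ L ↔ j < cs.length := fun j => List.mem_range
  have hmemis : ∀ i, i ∈ is ↔ 1 ≤ i ∧ i ≤ n := fun i => by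
    rw [his, List.mem_range'_1]; omega
  -- each clause is assigned to a variable that satisfies it whenever possible
  set g : ℕ → ℕ := fun j =>
    if α (clauseAt cs j).2.1 = (clauseAt cs j).2.2 then (clauseAt cs j).2.1
    else (clauseAt cs j).1.1 with hgdef
  have hgcases : ∀ j, g j = (clauseAt cs j).2.1 ∨ g j = (clauseAt cs j).1.1 := fun j => by
    simp only [hgdef]; split_ifs <;> simp
  have hgis : ∀ j ∈ L, g j ∈ is := fun j hj => by
    have := hg.1 _ (clauseAt_mem ((hmemL j).1 hj))
    rw [hmemis]
    rcases hgcases j with h | h <;> rw [h] <;> omega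
  have hgsat : ∀ j, clauseSat α (clauseAt cs j) = true →
      (clauseAt cs j).1 = (g j, α (g j)) ∨ (clauseAt cs j).2 = (g j, α (g j)) := fun j hj => by
    simp only [hgdef]
    split_ifs with h
    · exact .inr (Prod.ext rfl h.symm)
    · simp only [clauseSat, Bool.or_eq_true, beq_iff_eq, h, or_false] at hj
      exact .inl (Prod.ext rfl hj.symm)
  set S : ℕ → List ℕ := fun i => (L.filter fun j => g j == i).map fun j => cPl n (j + 1) with hSdef
  have hSlen : ∀ i, 1 ≤ i → i ≤ n → (S i).length ≤ 3 := fun i hi1 hi => by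
    have h1 := (countP_mentions_le cs i).trans (hg.2 i hi1 hi).2
    rw [← card_filter_getD cs ((0, true), (0, true))] at h1
    refine le_trans ?_ h1
    rw [hSdef, List.length_map, ← List.toFinset_card_of_nodup (List.nodup_range.filter _)]
    refine Finset.card_le_card fun j hj => ?_
    simp only [List.mem_toFinset, List.mem_filter, beq_iff_eq, Finset.mem_filter,
      Finset.mem_range, Bool.or_eq_true] at hj ⊢
    refine ⟨(hmemL j).1 hj.1, ?_⟩
    rcases hgcases j with h | h
    · exact .inr (h.symm.trans hj.2)
    · exact .inl (h.symm.trans hj.2)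
  have hflat : (is.flatMap S).Perm (L.map fun j => cPl n (j + 1)) := by
    rw [hSdef, ← List.map_flatMap]
    exact (perm_flatMap_filter List.nodup_range List.nodup_range' hgis).map _
  have hflen : (is.flatMap S).length = cs.length := by
    rw [hflat.length_eq, List.length_map, hL, List.length_range]
  have hm : cs.length ≤ 3 * n := by
    rw [← hflen, List.length_flatMap]
    refine (List.sum_le_card_nsmul _ 3 ?_).trans (by simp [his, mul_comm])
    intro x hx
    obtain ⟨i, hi, rfl⟩ := List.mem_map.1 hx
    exact hSlen i ((hmemis i).1 hi).1 ((hmemis i).1 hi).2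
  have hN := le_numP n
  set K := numP n - 6 * n - cs.length with hKdef
  have hK : K ≤ numP n - 6 * n := Nat.sub_le _ _
  set s : ℕ → ℤ := fun c =>
    if clauseSat α (clauseAt cs (numP n - 6 * n - 1 - c)) then 1 else 0 with hsdef
  have hs : ∀ j ∈ L, s (cPl n (j + 1)) = if clauseSat α (clauseAt cs j) then 1 else 0 := by
    intro j hj
    rw [hmemL] at hj
    have : numP n - 6 * n - 1 - cPl n (j + 1) = j := by simp only [cPl]; omega
    simp only [hsdef, this]
  have hsS : ∀ i, ∀ c ∈ S i, Slot n cs K (litPl n (i, α i)) c (s c) := by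
    intro i c hc
    simp only [hSdef, List.mem_map, List.mem_filter, beq_iff_eq] at hc
    obtain ⟨j, ⟨hj, rfl⟩, rfl⟩ := hc
    obtain ⟨hi1, hi⟩ := (hmemis _).1 (hgis j hj)
    have hj' := (hmemL j).1 hj
    have hlow : cPl n (j + 1) < numP n - 6 * n := by simp only [cPl]; omega
    refine ⟨hlow, .inl ⟨by simp only [cPl]; omega, fun r => ?_⟩⟩
    rw [hs j hj]
    split_ifs with h
    · rw [gv2_comm, gv2_of_oneGame (.inr ⟨j, hj', rfl, ?_⟩)]
      rcases hgsat j h with h | h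
      · exact .inl (by rw [← h])
      · exact .inr (by rw [← h])
    · exact gv2_nonneg_of_not_dxPlayer (not_dxPlayer_litPl hi1 hi _) (not_dxPlayer_of_lt hlow)
  have hsum : ((is.flatMap S).map s).sum = satCount α cs := by
    rw [(hflat.map s).sum_eq, List.map_map]
    have : L.map (s ∘ fun j => cPl n (j + 1)) =
        L.map fun j => if clauseSat α (clauseAt cs j) then (1 : ℤ) else 0 :=
      List.map_congr_left hs
    rw [this, satCount, ← card_filter_getD cs ((0, true), (0, true)), Finset.card_filter,
      Nat.cast_sum, ← List.sum_toFinset _ List.nodup_range, List.toFinset_range]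
    exact Finset.sum_congr rfl fun j _ => by split_ifs <;> rfl
  obtain ⟨j, hj⟩ : ∃ j, Nat.clog 2 (16 * n) = 4 + j := by
    refine ⟨_, (Nat.add_sub_cancel' ?_).symm⟩
    rw [← Nat.pow_le_pow_iff_right (a := 2) one_lt_two]
    exact le_trans (by omega) hN
  have hNj : numP n = 16 * 2 ^ j := by rw [numP, hj, pow_add]; norm_num
  have hlen_is : is.length = n := List.length_range'
  obtain ⟨F₁, F₂, hF, hF₁⟩ : ∃ F₁ F₂, List.range K = F₁ ++ F₂ ∧ F₁.length = 10 * n - cs.length :=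
    ⟨_, _, (List.take_append_drop (10 * n - cs.length) _).symm, by
      rw [List.length_take, List.length_range]; omega⟩
  have hFlen : F₁.length + F₂.length = K := by
    rw [← List.length_append, ← hF, List.length_range]
  have hFK : ∀ f ∈ F₁ ++ F₂, f < K := fun f hf => List.mem_range.1 (hF ▸ hf)
  obtain ⟨B, b1, b2, b3, b4⟩ := exists_variable_blocks hK hSlen hsS is F₁
    (fun i => (hmemis i).1) (by rw [hflen, hlen_is]; omega)
    fun f hf => hFK f (List.mem_append_left _ hf)
  obtain ⟨D, d1, d2, d3, d4⟩ := exists_dummy_blocks (cs := cs) hK (2 ^ j - n) F₂ (by omega)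
    fun f hf => hFK f (List.mem_append_right _ hf)
  obtain ⟨-, -, h⟩ := sum_blocks_le_tourValue (cs := cs) j (B ++ D)
    (by rw [List.length_append]; omega) fun l hl => (List.mem_append.1 hl).elim (b2 l) (d2 l)
  refine ⟨(B ++ D).flatten, ?_, ?_⟩
  · have hperm : (B ++ D).flatten.Perm (is.flatMap (variablePlayers n) ++
        (L.map fun j => cPl n (j + 1)) ++ List.range K) := by
      rw [List.flatten_append, d3, hF, ← List.append_assoc]
      exact (b3.trans ((hflat.append_left _).append_right _)).append_right _
    refine isSeeding_of_perm hperm ?_ fun a ha => ?_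
    · have : (is.flatMap (variablePlayers n)).length = 6 * n := by
        simp [List.length_flatMap, variablePlayers, hlen_is, mul_comm]
      simp only [List.length_append, this, List.length_map, hL, List.length_range]
      omega
    · simp only [List.mem_append, List.mem_flatMap, List.mem_map, List.mem_range, hmemL, hmemis,
        variablePlayers, List.mem_cons, List.not_mem_nil, or_false]
      by_cases h1 : a < K
      · exact .inr h1
      by_cases h2 : a < numP n - 6 * n
      · exact .inl (.inr ⟨numP n - 6 * n - 1 - a, by omega, by simp only [cPl]; omega⟩)
      refine .inl (.inl ?_)
      simp only [dHat, dMid, dTil, xPl, xTPl, xFPl]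
      by_cases h3 : a < numP n - 3 * n
      · exact ⟨(numP n - 3 * n - a + 2) / 3, by omega, by omega⟩
      · exact ⟨(numP n - a + 2) / 3, by omega, by omega⟩
  · rw [List.map_append, List.sum_append] at h
    rw [hj]
    rw [hsum, hlen_is] at b4
    linarith

/-- The maximum tournament value over all seedings of the
Construction 2 instance `T_φ` equals the maximum number `M` of simultaneously
satisfiable clauses of the (2,3)-CNF formula `φ` plus `n`. -/
theorem stmt_10 (n : ℕ) (cs : List Clause2) (hgood : Good23 n cs)
    (M : ℕ) (hM : IsGreatest {k : ℕ | ∃ α : ℕ → Bool, satCount α cs = k} M) :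
    IsGreatest {V : ℤ | ∃ l : List ℕ, IsSeeding (Finset.range (numP n)) l ∧
        tourValue (gv2 n cs) (Nat.clog 2 (16 * n)) l = V} ((M : ℤ) + n) := by
  rcases Nat.eq_zero_or_pos n with rfl | hn
  · have hcs : cs = [] := List.eq_nil_iff_forall_not_mem.2 fun c hc => by
      have := hgood.1 c hc
      omega
    subst hcs
    obtain rfl : M = 0 := by
      obtain ⟨α, rfl⟩ := hM.1
      rfl
    refine ⟨⟨[0], ⟨List.nodup_singleton 0, by simp [numP]⟩, by simp [tourValue]⟩, ?_⟩
    rintro V ⟨l, -, rfl⟩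
    simp [tourValue]
  · have hub : ∀ l, IsSeeding (Finset.range (numP n)) l →
        tourValue (gv2 n cs) (Nat.clog 2 (16 * n)) l ≤ M + n := by
      rintro l ⟨hnd, hl⟩
      have hlen : l.length = numP n := by
        rw [← List.toFinset_card_of_nodup hnd, hl, Finset.card_range]
      have hpos : 0 < numP n := by have := le_numP n; omega
      have hmem : ∀ a, a ∈ l ↔ a < numP n := fun a => by
        rw [← List.mem_toFinset, hl, Finset.mem_range]
      have hw : winner l = numP n - 1 := by
        have h1 := (hmem _).1 (winner_mem (List.ne_nil_of_length_pos (hlen ▸ hpos)))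
        have h2 := le_winner ((hmem (numP n - 1)).2 (by omega))
        omega
      obtain ⟨β, ρ, k⟩ := exists_knockout (gv2_comm n cs) _ l hlen hnd
      rw [hl, hw] at k
      exact k.value_le hn hgood fun α => hM.2 ⟨α, rfl⟩
    refine ⟨?_, fun V ⟨l, hl, hV⟩ => hV ▸ hub l hl⟩
    obtain ⟨α, rfl⟩ := hM.1
    obtain ⟨l, hl, hV⟩ := exists_seeding_ge hn hgood α
    exact ⟨l, hl, le_antisymm (hub l hl) hV⟩
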